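/- In every finite three-person game there exists a Pareto optimal conditional strategy equilibrium: a conditional strategy equilibrium s whose distinguished fixed point ā is a Pareto optimal action profile of the underlying game. -/

import Mathlib

namespace CondStrat3

open scoped Classical

variable {A₁ A₂ A₃ : Type*}

/-- A fixed point of the three-person conditional strategy profile. -/
def FixPt (s₁ : A₂ × A₃ → A₁) (s₂ : A₁ × A₃ → A₂) (s₃ : A₁ × A₂ → A₃)
    (a : A₁ × A₂ × A₃) : Prop :=
  s₁ (a.2.1, a.2.2) = a.1 ∧ s₂ (a.1, a.2.2) = a.2.1 ∧ s₃ (a.1, a.2.1) = a.2.2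

/-- `a` is a distinguished fixed point: a fixed point weakly Pareto dominating
every fixed point of the profile.  The profile is an *agreement* iff one exists. -/
def BestFixPt (u₁ u₂ u₃ : A₁ × A₂ × A₃ → ℝ)
    (s₁ : A₂ × A₃ → A₁) (s₂ : A₁ × A₃ → A₂) (s₃ : A₁ × A₂ → A₃)
    (a : A₁ × A₂ × A₃) : Prop :=
  FixPt s₁ s₂ s₃ a ∧ ∀ a', FixPt s₁ s₂ s₃ a' →
    u₁ a' ≤ u₁ a ∧ u₂ a' ≤ u₂ a ∧ u₃ a' ≤ u₃ a

/-- Payoff `u` at the distinguished fixed point for agreements, `0` otherwise. -/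
noncomputable def Upay (u₁ u₂ u₃ u : A₁ × A₂ × A₃ → ℝ)
    (s₁ : A₂ × A₃ → A₁) (s₂ : A₁ × A₃ → A₂) (s₃ : A₁ × A₂ → A₃) : ℝ :=
  if h : ∃ a, BestFixPt u₁ u₂ u₃ s₁ s₂ s₃ a then u h.choose else 0

/-- Conditional strategy equilibrium: no unilaterally profitable deviation. -/
def CSE (u₁ u₂ u₃ : A₁ × A₂ × A₃ → ℝ)
    (s₁ : A₂ × A₃ → A₁) (s₂ : A₁ × A₃ → A₂) (s₃ : A₁ × A₂ → A₃) : Prop :=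
  (∀ s₁', Upay u₁ u₂ u₃ u₁ s₁' s₂ s₃ ≤ Upay u₁ u₂ u₃ u₁ s₁ s₂ s₃) ∧
  (∀ s₂', Upay u₁ u₂ u₃ u₂ s₁ s₂' s₃ ≤ Upay u₁ u₂ u₃ u₂ s₁ s₂ s₃) ∧
  (∀ s₃', Upay u₁ u₂ u₃ u₃ s₁ s₂ s₃' ≤ Upay u₁ u₂ u₃ u₃ s₁ s₂ s₃)

/-- Pareto optimality of an action profile. -/
def ParetoOpt (u₁ u₂ u₃ : A₁ × A₂ × A₃ → ℝ) (a : A₁ × A₂ × A₃) : Prop :=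
  ¬ ∃ a', (u₁ a ≤ u₁ a' ∧ u₂ a ≤ u₂ a' ∧ u₃ a ≤ u₃ a') ∧
    (u₁ a < u₁ a' ∨ u₂ a < u₂ a' ∨ u₃ a < u₃ a')

theorem Upay_le_of (u₁ u₂ u₃ u : A₁ × A₂ × A₃ → ℝ)
    (s₁ : A₂ × A₃ → A₁) (s₂ : A₁ × A₃ → A₂) (s₃ : A₁ × A₂ → A₃) (r : ℝ) (hr : 0 ≤ r)
    (h : ∀ a, FixPt s₁ s₂ s₃ a → u a ≤ r) : Upay u₁ u₂ u₃ u s₁ s₂ s₃ ≤ r := by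
  unfold Upay
  split_ifs with hh
  · exact h _ hh.choose_spec.1
  · exact hr

theorem Upay_eq_of (u₁ u₂ u₃ u : A₁ × A₂ × A₃ → ℝ)
    (s₁ : A₂ × A₃ → A₁) (s₂ : A₁ × A₃ → A₂) (s₃ : A₁ × A₂ → A₃) (b : A₁ × A₂ × A₃)
    (hb : BestFixPt u₁ u₂ u₃ s₁ s₂ s₃ b)
    (h : ∀ a, FixPt s₁ s₂ s₃ a → a = b) : Upay u₁ u₂ u₃ u s₁ s₂ s₃ = u b := by
  have hh : ∃ a, BestFixPt u₁ u₂ u₃ s₁ s₂ s₃ a := ⟨b, hb⟩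
  unfold Upay
  rw [dif_pos hh, h _ hh.choose_spec.1]

/-- every finite three-person game (each player having at least two
actions) has a Pareto optimal conditional strategy equilibrium: a conditional
strategy equilibrium whose distinguished fixed point is Pareto optimal. -/
theorem pareto_cse_exists [Fintype A₁] [Fintype A₂] [Fintype A₃]
    (hA₁ : 1 < Fintype.card A₁) (hA₂ : 1 < Fintype.card A₂) (hA₃ : 1 < Fintype.card A₃)
    (u₁ u₂ u₃ : A₁ × A₂ × A₃ → ℝ)
    (hu₁ : ∀ a, 0 ≤ u₁ a) (hu₂ : ∀ a, 0 ≤ u₂ a) (hu₃ : ∀ a, 0 ≤ u₃ a) :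
    ∃ (s₁ : A₂ × A₃ → A₁) (s₂ : A₁ × A₃ → A₂) (s₃ : A₁ × A₂ → A₃) (abar : A₁ × A₂ × A₃),
      CSE u₁ u₂ u₃ s₁ s₂ s₃ ∧
      BestFixPt u₁ u₂ u₃ s₁ s₂ s₃ abar ∧
      ParetoOpt u₁ u₂ u₃ abar := by
  obtain ⟨x₁, -, -⟩ := Fintype.one_lt_card_iff.1 hA₁
  obtain ⟨x₂, -, -⟩ := Fintype.one_lt_card_iff.1 hA₂
  obtain ⟨x₃, -, -⟩ := Fintype.one_lt_card_iff.1 hA₃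
  haveI : Nonempty (A₁ × A₂ × A₃) := ⟨(x₁, x₂, x₃)⟩
  -- a lexicographic maximizer of the utilities is Pareto optimal
  obtain ⟨⟨z₁, z₂, z₃⟩, hz⟩ := Finite.exists_max
    (fun a : A₁ × A₂ × A₃ => toLex (u₁ a, toLex (u₂ a, u₃ a)))
  simp only [Prod.Lex.toLex_le_toLex] at hz
  have hmax : ∀ a, u₁ a ≤ u₁ (z₁, z₂, z₃) := fun a => by
    rcases hz a with h | h
    · exact h.le
    · exact h.1.le
  have hP : ParetoOpt u₁ u₂ u₃ (z₁, z₂, z₃) := by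
    rintro ⟨a, ⟨h1, h2, h3⟩, h4⟩
    rcases hz a with h | ⟨h, h' | ⟨h', h''⟩⟩
    · linarith
    · linarith
    · rcases h4 with h4 | h4 | h4 <;> linarith
  obtain ⟨w₁, hw₁⟩ := Fintype.exists_ne_of_one_lt_card hA₁ z₁
  obtain ⟨w₂, hw₂⟩ := Fintype.exists_ne_of_one_lt_card hA₂ z₂
  obtain ⟨w₃, hw₃⟩ := Fintype.exists_ne_of_one_lt_card hA₃ z₃
  -- player 1 plays AND, players 2 and 3 play XOR
  let s₁ : A₂ × A₃ → A₁ := fun p => if p.1 ≠ z₂ ∧ p.2 ≠ z₃ then w₁ else z₁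
  let s₂ : A₁ × A₃ → A₂ := fun p => if (p.1 = z₁ ↔ p.2 = z₃) then z₂ else w₂
  let s₃ : A₁ × A₂ → A₃ := fun p => if (p.1 = z₁ ↔ p.2 = z₂) then z₃ else w₃
  have hF3 : ∀ a : A₁ × A₂ × A₃, s₁ (a.2.1, a.2.2) = a.1 → s₂ (a.1, a.2.2) = a.2.1 →
      a.1 = z₁ ∧ a.2.1 = z₂ ∧ a.2.2 = z₃ := by
    rintro ⟨a, b, c⟩ h1 h2
    simp only [s₁, s₂] at h1 h2 ⊢
    grind
  have hF2 : ∀ a : A₁ × A₂ × A₃, s₁ (a.2.1, a.2.2) = a.1 → s₃ (a.1, a.2.1) = a.2.2 →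
      a.1 = z₁ ∧ a.2.1 = z₂ ∧ a.2.2 = z₃ := by
    rintro ⟨a, b, c⟩ h1 h2
    simp only [s₁, s₃] at h1 h2 ⊢
    grind
  have hfix : FixPt s₁ s₂ s₃ (z₁, z₂, z₃) := by
    simp [FixPt, s₁, s₂, s₃]
  have e2 : ∀ s₂', ∀ a, FixPt s₁ s₂' s₃ a → a = (z₁, z₂, z₃) := by
    rintro s₂' ⟨a, b, c⟩ ⟨h1, -, h3⟩
    obtain ⟨k1, k2, k3⟩ := hF2 (a, b, c) h1 h3
    exact Prod.ext k1 (Prod.ext k2 k3)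
  have e3 : ∀ s₃', ∀ a, FixPt s₁ s₂ s₃' a → a = (z₁, z₂, z₃) := by
    rintro s₃' ⟨a, b, c⟩ ⟨h1, h2, -⟩
    obtain ⟨k1, k2, k3⟩ := hF3 (a, b, c) h1 h2
    exact Prod.ext k1 (Prod.ext k2 k3)
  have hB : BestFixPt u₁ u₂ u₃ s₁ s₂ s₃ (z₁, z₂, z₃) := by
    refine ⟨hfix, fun a ha => ?_⟩
    rw [e2 _ a ha]
    exact ⟨le_rfl, le_rfl, le_rfl⟩
  refine ⟨s₁, s₂, s₃, (z₁, z₂, z₃), ⟨fun t => ?_, fun t => ?_, fun t => ?_⟩, hB, hP⟩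
  · rw [Upay_eq_of u₁ u₂ u₃ u₁ s₁ s₂ s₃ _ hB (e2 s₂)]
    exact Upay_le_of _ _ _ _ _ _ _ _ (hu₁ _) fun a _ => hmax a
  · rw [Upay_eq_of u₁ u₂ u₃ u₂ s₁ s₂ s₃ _ hB (e2 s₂)]
    exact Upay_le_of _ _ _ _ _ _ _ _ (hu₂ _) fun a ha => by rw [e2 _ a ha]
  · rw [Upay_eq_of u₁ u₂ u₃ u₃ s₁ s₂ s₃ _ hB (e2 s₂)]
    exact Upay_le_of _ _ _ _ _ _ _ _ (hu₃ _) fun a ha => by rw [e3 _ a ha]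

end CondStrat3
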